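/- Let C₁ > 0, 1 < b < 2 and ε > 0. There exists a constant C_ε > 0 (depending only on C₁, b, ε) such that for every f ∈ L¹(ℝ³) the function Q_ε(f,f) is defined almost everywhere, belongs to L¹(ℝ³), and satisfies ‖Q_ε(f,f)‖_{L¹} ≤ C_ε ‖f‖_{L¹}². -/

import Mathlib

noncomputable section

open MeasureTheory Real Metric
open scoped RealInnerProductSpace

/-- Momentum space `ℝ³`. -/
abbrev R3 : Type := EuclideanSpace ℝ (Fin 3)

/-- The relative momentum `ρ(p,q) = √(2(|p||q| − p·q))`. -/
def relMom (p q : R3) : ℝ := Real.sqrt (2 * (‖p‖ * ‖q‖ - ⟪p, q⟫))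

/-- Post-collision momentum `p'`. -/
def pPost (p q ω : R3) : R3 :=
  (1 / 2 : ℝ) • (p + q) + (relMom p q / 2) • ω
    + (⟪p + q, ω⟫ / 2 / (‖p‖ + ‖q‖ + relMom p q)) • (p + q)

/-- Post-collision momentum `q'`. -/
def qPost (p q ω : R3) : R3 :=
  (1 / 2 : ℝ) • (p + q) - (relMom p q / 2) • ω
    - (⟪p + q, ω⟫ / 2 / (‖p‖ + ‖q‖ + relMom p q)) • (p + q)

/-- Post-collision energy `p'⁰`. -/
def p0Post (p q ω : R3) : ℝ := (‖p‖ + ‖q‖) / 2 + ⟪p + q, ω⟫ / 2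

/-- Post-collision energy `q'⁰`. -/
def q0Post (p q ω : R3) : ℝ := (‖p‖ + ‖q‖) / 2 - ⟪p + q, ω⟫ / 2

/-- The surface measure `dω` on the unit sphere `S² ⊂ ℝ³` (total mass `4π`). -/
def sphMeasure : Measure (sphere (0 : R3) 1) := (volume : Measure R3).toSphere

/-- The (modified, for `ε > 0`) massless Boltzmann collision operator with scattering
cross-section `σ = C₁ h^{-b}`. -/
def Qcoll (C₁ b ε : ℝ) (f : R3 → ℝ) (p : R3) : ℝ :=
  C₁ * ∫ q : R3, ∫ ω : sphere (0 : R3) 1,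
      (if ε ≤ relMom p q then relMom p q ^ (2 - b) / (‖p‖ * ‖q‖) else 0)
        * (f (pPost p q ω) * f (qPost p q ω) - f p * f q) ∂sphMeasure


/-- Energy as a function of the total momentum and the centre-of-mass variable. -/
def enE (P x : R3) : ℝ := Real.sqrt (4 * ‖x‖ ^ 2 + ‖P‖ ^ 2)

/-- The coefficient of `P` in the parametrization. -/
def uCo (P x : R3) : ℝ := ⟪P, x⟫ / (2 * ‖x‖ * (enE P x + 2 * ‖x‖))

/-- The parametrization of `p` with given total momentum. -/
def Phi (P x : R3) : R3 := (1 / 2 : ℝ) • P + x + uCo P x • P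

lemma enE_sq (P x : R3) : enE P x ^ 2 = 4 * ‖x‖ ^ 2 + ‖P‖ ^ 2 :=
  Real.sq_sqrt (by positivity)

lemma enE_pos (P : R3) {x : R3} (hx : x ≠ 0) : 0 < enE P x := by
  have : 0 < ‖x‖ := norm_pos_iff.2 hx
  exact Real.sqrt_pos.2 (by positivity)

lemma Phi_neg (P x : R3) : Phi P (-x) = P - Phi P x := by
  simp only [Phi, uCo, enE, norm_neg, inner_neg_right, neg_div]
  module

lemma norm_Phi (P : R3) {x : R3} (hx : x ≠ 0) :
    ‖Phi P x‖ = enE P x / 2 + ⟪P, x⟫ / (2 * ‖x‖) := by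
  have hn : 0 < ‖x‖ := norm_pos_iff.2 hx
  have hE := enE_pos P hx
  have hE2 := enE_sq P x
  have hs : |⟪P, x⟫| ≤ ‖P‖ * ‖x‖ := abs_real_inner_le_norm P x
  have hPE : ‖P‖ ≤ enE P x := by
    apply Real.le_sqrt_of_sq_le
    nlinarith [sq_nonneg ‖x‖]
  have h0 : 0 ≤ enE P x / 2 + ⟪P, x⟫ / (2 * ‖x‖) := by
    have : -(enE P x * ‖x‖) ≤ ⟪P, x⟫ := by
      have := (abs_le.1 hs).1
      nlinarith
    have h2 : enE P x / 2 + ⟪P, x⟫ / (2 * ‖x‖) = (enE P x * ‖x‖ + ⟪P, x⟫) / (2 * ‖x‖) := by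
      field_simp
    rw [h2]
    apply div_nonneg <;> linarith
  rw [← sq_eq_sq₀ (norm_nonneg _) h0]
  have h1 : Phi P x = (1 / 2 + uCo P x) • P + x := by
    simp only [Phi]; module
  rw [h1, norm_add_sq_real, norm_smul, inner_smul_left, mul_pow, Real.norm_eq_abs, sq_abs]
  simp only [uCo, conj_trivial]
  have hP : ‖P‖ ^ 2 = enE P x ^ 2 - 4 * ‖x‖ ^ 2 := by linarith
  rw [hP]
  generalize enE P x = E at *
  generalize ‖x‖ = n at *
  generalize ⟪P, x⟫ = s at *
  field_simp
  ring

lemma norm_sub_Phi (P : R3) {x : R3} (hx : x ≠ 0) :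
    ‖P - Phi P x‖ = enE P x / 2 - ⟪P, x⟫ / (2 * ‖x‖) := by
  rw [← Phi_neg, norm_Phi P (neg_ne_zero.2 hx)]
  simp only [enE, norm_neg, inner_neg_right]
  ring

lemma relMom_eq (p q : R3) : relMom p q = Real.sqrt ((‖p‖ + ‖q‖) ^ 2 - ‖p + q‖ ^ 2) := by
  rw [relMom, norm_add_sq_real]
  congr 1; ring

lemma relMom_sq (p q : R3) : relMom p q ^ 2 = (‖p‖ + ‖q‖) ^ 2 - ‖p + q‖ ^ 2 := by
  rw [relMom_eq, Real.sq_sqrt]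
  have := norm_add_le p q
  have := norm_nonneg (p + q)
  nlinarith

lemma relMom_nonneg (p q : R3) : 0 ≤ relMom p q := Real.sqrt_nonneg _

lemma energy_Phi (P : R3) {x : R3} (hx : x ≠ 0) :
    ‖Phi P x‖ + ‖P - Phi P x‖ = enE P x := by
  rw [norm_Phi P hx, norm_sub_Phi P hx]; ring

lemma relMom_Phi (P : R3) {x : R3} (hx : x ≠ 0) :
    relMom (Phi P x) (P - Phi P x) = 2 * ‖x‖ := by
  rw [relMom_eq, energy_Phi P hx, enE_sq, add_sub_cancel, add_sub_cancel_right,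
    show 4 * ‖x‖ ^ 2 = (2 * ‖x‖) ^ 2 by ring, Real.sqrt_sq (by positivity)]

/-- The inverse parametrization. -/
def Psi (P p : R3) : R3 :=
  p - (1 / 2 : ℝ) • P - (⟪P, p - (1 / 2 : ℝ) • P⟫ / ((‖p‖ + ‖P - p‖)
    * (‖p‖ + ‖P - p‖ + relMom p (P - p)))) • P

lemma Psi_Phi (P : R3) {x : R3} (hx : x ≠ 0) : Psi P (Phi P x) = x := by
  have hn : 0 < ‖x‖ := norm_pos_iff.2 hx
  have hE := enE_pos P hx
  have hE2 := enE_sq P x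
  rw [Psi, energy_Phi P hx, relMom_Phi P hx]
  have h1 : Phi P x - (1 / 2 : ℝ) • P = x + uCo P x • P := by simp only [Phi]; module
  rw [h1, inner_add_right, inner_smul_right, real_inner_self_eq_norm_sq]
  have : (⟪P, x⟫ + uCo P x * ‖P‖ ^ 2) / (enE P x * (enE P x + 2 * ‖x‖)) = uCo P x := by
    simp only [uCo]
    have hP : ‖P‖ ^ 2 = enE P x ^ 2 - 4 * ‖x‖ ^ 2 := by linarith
    rw [hP]
    generalize enE P x = E at *
    generalize ‖x‖ = n at *
    generalize ⟪P, x⟫ = s at *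
    field_simp
    ring
  rw [this]; module

lemma Phi_Psi (P p : R3) (h : 0 < relMom p (P - p)) : Psi P p ≠ 0 ∧ Phi P (Psi P p) = p := by
  have hr2 := relMom_sq p (P - p)
  rw [add_sub_cancel] at hr2
  set r := relMom p (P - p) with hr
  set E := ‖p‖ + ‖P - p‖ with hE
  have hE0 : 0 < E := by
    have : 0 ≤ E := by positivity
    rcases this.eq_or_lt with h0 | h0
    · rw [← h0] at hr2
      nlinarith [sq_nonneg ‖P‖, pow_pos h 2]
    · exact h0
  set y := p - (1 / 2 : ℝ) • P with hy
  have hp : p = y + (1 / 2 : ℝ) • P := by rw [hy]; module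
  have hq : P - p = (1 / 2 : ℝ) • P - y := by rw [hy]; module
  set t := ⟪P, y⟫ with ht
  have hyt : ⟪y, P⟫ = t := real_inner_comm _ _
  have hp2 : ‖p‖ ^ 2 = ‖y‖ ^ 2 + t + ‖P‖ ^ 2 / 4 := by
    rw [hp, norm_add_sq_real, norm_smul, inner_smul_right, hyt]
    norm_num; ring
  have hq2 : ‖P - p‖ ^ 2 = ‖y‖ ^ 2 - t + ‖P‖ ^ 2 / 4 := by
    rw [hq, norm_sub_sq_real, norm_smul, inner_smul_left, ← ht]
    norm_num; ring
  have hdiff : (‖p‖ - ‖P - p‖) * E = 2 * t := by rw [hE]; linarith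
  have hdiff' : ‖p‖ - ‖P - p‖ = 2 * t / E := by field_simp; linarith
  have hy2 : ‖y‖ ^ 2 = r ^ 2 / 4 + t ^ 2 / E ^ 2 := by
    have h3 : E ^ 2 + (‖p‖ - ‖P - p‖) ^ 2 = 4 * ‖y‖ ^ 2 + ‖P‖ ^ 2 := by
      rw [hE]; linarith
    rw [hdiff', div_pow] at h3
    have : t ^ 2 / E ^ 2 = (2 * t) ^ 2 / E ^ 2 / 4 := by ring
    rw [this]; linarith
  have hP2 : ‖P‖ ^ 2 = E ^ 2 - r ^ 2 := by linarith
  set c := t / (E * (E + r)) with hc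
  have hPsi : Psi P p = y - c • P := rfl
  have hx2 : ‖Psi P p‖ ^ 2 = (r / 2) ^ 2 := by
    rw [hPsi, norm_sub_sq_real, norm_smul, inner_smul_right, hyt, mul_pow, Real.norm_eq_abs,
      sq_abs, hP2, hy2, hc]
    clear_value r E t
    field_simp
    ring
  have hx : ‖Psi P p‖ = r / 2 := by
    rwa [sq_eq_sq₀ (norm_nonneg _) (by positivity)] at hx2
  have hEn : enE P (Psi P p) = E := by
    rw [enE, hx, hP2, show 4 * (r / 2) ^ 2 + (E ^ 2 - r ^ 2) = E ^ 2 by ring,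
      Real.sqrt_sq hE0.le]
  refine ⟨norm_pos_iff.1 (by rw [hx]; positivity), ?_⟩
  have hu : uCo P (Psi P p) = c := by
    rw [uCo, hEn, hx, hPsi, inner_sub_right, inner_smul_right, real_inner_self_eq_norm_sq, hP2,
      ← ht, hc]
    clear_value r E t
    field_simp
    ring
  rw [Phi, hu, hPsi, hp]; module

lemma image_Phi (P : R3) : Phi P '' {0}ᶜ = {p | 0 < relMom p (P - p)} := by
  ext p
  constructor
  · rintro ⟨x, hx, rfl⟩
    have hx : x ≠ 0 := hx
    have hn : 0 < ‖x‖ := norm_pos_iff.2 hx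
    simp only [Set.mem_ofPred_eq, relMom_Phi P hx]
    positivity
  · intro h
    exact ⟨Psi P p, (Phi_Psi P p h).1, (Phi_Psi P p h).2⟩

lemma injOn_Phi (P : R3) : Set.InjOn (Phi P) {0}ᶜ := by
  intro x hx y hy h
  rw [← Psi_Phi P hx, ← Psi_Phi P hy, h]

lemma differentiableAt_uCo (P : R3) {x : R3} (hx : x ≠ 0) : DifferentiableAt ℝ (uCo P) x := by
  have hn : 0 < ‖x‖ := norm_pos_iff.2 hx
  have hE := enE_pos P hx
  have h1 : DifferentiableAt ℝ (fun x : R3 => ‖x‖) x := differentiableAt_id.norm ℝ hx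
  have h2 : DifferentiableAt ℝ (enE P) x := by
    apply DifferentiableAt.sqrt
    · fun_prop
    · positivity
  have h3 : DifferentiableAt ℝ (fun x : R3 => ⟪P, x⟫) x :=
    (differentiableAt_const P).inner ℝ differentiableAt_id
  unfold uCo
  have h4 : DifferentiableAt ℝ (fun x : R3 => 2 * ‖x‖ * (enE P x + 2 * ‖x‖)) x :=
    (h1.const_mul 2).mul (h2.add (h1.const_mul 2))
  have h5 : 2 * ‖x‖ * (enE P x + 2 * ‖x‖) ≠ 0 := by positivity
  have h6 := h3.mul (h4.inv h5)
  exact h6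

lemma fderiv_uCo (P : R3) {x : R3} (hx : x ≠ 0) :
    1 + fderiv ℝ (uCo P) x P = 4 * ‖Phi P x‖ * ‖P - Phi P x‖ / (enE P x * (2 * ‖x‖)) := by
  have hn : 0 < ‖x‖ := norm_pos_iff.2 hx
  have hE := enE_pos P hx
  have hE2 := enE_sq P x
  have hline : HasDerivAt (fun t : ℝ => x + t • P) P 0 := by
    simpa using ((hasDerivAt_id (0 : ℝ)).smul_const P).const_add x
  have hd : HasDerivAt (fun t : ℝ => uCo P (x + t • P)) (fderiv ℝ (uCo P) x P) 0 := by
    have h := (differentiableAt_uCo P hx).hasFDerivAt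
    have h' : HasFDerivAt (uCo P) (fderiv ℝ (uCo P) x) (x + (0 : ℝ) • P) := by simpa using h
    exact h'.comp_hasDerivAt 0 hline
  have hs : HasDerivAt (fun t : ℝ => ⟪P, x + t • P⟫) (‖P‖ ^ 2) 0 := by
    have := (hasDerivAt_const (0 : ℝ) P).inner ℝ hline
    simpa using this
  have hnsq : HasDerivAt (fun t : ℝ => ‖x + t • P‖ ^ 2) (2 * ⟪P, x⟫) 0 := by
    have := hline.norm_sq
    simpa [real_inner_comm] using this
  have hN : HasDerivAt (fun t : ℝ => ‖x + t • P‖) (⟪P, x⟫ / ‖x‖) 0 := by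
    have := hnsq.sqrt (by simpa using hn.ne')
    simp only [Real.sqrt_sq (norm_nonneg _)] at this
    convert this using 1
    simp; field_simp
  have hEd : HasDerivAt (fun t : ℝ => enE P (x + t • P)) (4 * ⟪P, x⟫ / enE P x) 0 := by
    have h0 : 4 * ‖x + (0 : ℝ) • P‖ ^ 2 + ‖P‖ ^ 2 ≠ 0 := by simp; positivity
    have := ((hnsq.const_mul 4).add_const (‖P‖ ^ 2)).sqrt h0
    refine this.congr_deriv ?_
    rw [zero_smul, add_zero]
    change _ / (2 * enE P x) = _
    field_simp
  have hall := hs.div ((hN.const_mul 2).mul (hEd.add (hN.const_mul 2)))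
    (by simp; constructor; exact hx; positivity)
  have hu := hd.unique hall
  rw [hu, norm_Phi P hx, norm_sub_Phi P hx]
  simp only [zero_smul, add_zero, Pi.mul_apply, Pi.add_apply]
  have hP : ‖P‖ ^ 2 = enE P x ^ 2 - 4 * ‖x‖ ^ 2 := by linarith
  rw [hP]
  generalize enE P x = E at *
  generalize ‖x‖ = n at *
  generalize ⟪P, x⟫ = s at *
  field_simp
  ring

/-- Derivative of `Phi`. -/
def dPhi (P x : R3) : R3 →L[ℝ] R3 :=
  ContinuousLinearMap.id ℝ R3 + (fderiv ℝ (uCo P) x).smulRight P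

lemma hasFDerivAt_Phi (P : R3) {x : R3} (hx : x ≠ 0) : HasFDerivAt (Phi P) (dPhi P x) x := by
  have h := (differentiableAt_uCo P hx).hasFDerivAt
  exact ((hasFDerivAt_id x).const_add ((1 / 2 : ℝ) • P)).add (h.smul_const P)

lemma det_dPhi (P : R3) {x : R3} (hx : x ≠ 0) :
    (dPhi P x).det = 4 * ‖Phi P x‖ * ‖P - Phi P x‖ / (enE P x * (2 * ‖x‖)) := by
  rw [← fderiv_uCo P hx]
  have : ((dPhi P x : R3 →L[ℝ] R3) : R3 →ₗ[ℝ] R3)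
      = LinearMap.transvection ((fderiv ℝ (uCo P) x : R3 →L[ℝ] ℝ) : R3 →ₗ[ℝ] ℝ) P := by
    ext y; simp [dPhi, LinearMap.transvection]
  rw [ContinuousLinearMap.det, this, LinearMap.transvection.det]
  rfl

lemma change_Phi (P : R3) (g : R3 → ENNReal) :
    ∫⁻ p in {p | 0 < relMom p (P - p)}, g p = ∫⁻ x in {0}ᶜ,
      ENNReal.ofReal (4 * ‖Phi P x‖ * ‖P - Phi P x‖ / (enE P x * (2 * ‖x‖))) * g (Phi P x) := by
  have hm : MeasurableSet ({0}ᶜ : Set R3) := (measurableSet_singleton _).compl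
  rw [← image_Phi, lintegral_image_eq_lintegral_abs_det_fderiv_mul volume hm
    (fun x hx => (hasFDerivAt_Phi P hx).hasFDerivWithinAt) (injOn_Phi P)]
  refine setLIntegral_congr_fun hm fun x hx => ?_
  have hE := enE_pos P hx
  rw [det_dPhi P hx, abs_of_nonneg (by positivity)]

lemma polar_lintegral (H : R3 → ENNReal) (hH : Measurable H) :
    ∫⁻ x, H x = ∫⁻ ω : sphere (0 : R3) 1, ∫⁻ r : Set.Ioi (0 : ℝ), H ((r : ℝ) • (ω : R3))
      ∂(Measure.volumeIoiPow (Module.finrank ℝ R3 - 1)) ∂sphMeasure := by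
  have h1 := (volume : Measure R3).measurePreserving_homeomorphUnitSphereProd
  rw [sphMeasure, ← lintegral_prod
    (f := fun z : sphere (0 : R3) 1 × Set.Ioi (0 : ℝ) => H ((z.2 : ℝ) • (z.1 : R3)))
    (by fun_prop),
    ← h1.lintegral_comp (by fun_prop)]
  have h2 : ∫⁻ x, H x = ∫⁻ x in ({0}ᶜ : Set R3), H x := by rw [restrict_compl_singleton]
  rw [h2, ← lintegral_subtype_comap (measurableSet_singleton (0 : R3)).compl]
  refine lintegral_congr fun x => ?_
  have hx : (x : R3) ≠ 0 := x.2
  have hn : ‖(x : R3)‖ ≠ 0 := norm_ne_zero_iff.2 hx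
  simp [smul_smul, hn]

lemma polar_avg (H : R3 → ENNReal) (hH : Measurable H) :
    ∫⁻ x : R3, ∫⁻ ω : sphere (0 : R3) 1, H (‖x‖ • (ω : R3)) ∂sphMeasure
      = sphMeasure Set.univ * ∫⁻ x, H x := by
  have : IsFiniteMeasure sphMeasure := by unfold sphMeasure; infer_instance
  rw [polar_lintegral H hH, polar_lintegral]
  · have : ∀ ω : sphere (0 : R3) 1, ∀ r : Set.Ioi (0 : ℝ),
        ‖(r : ℝ) • (ω : R3)‖ = (r : ℝ) := by
      intro ω r
      have h := r.2
      rw [norm_smul, norm_eq_of_mem_sphere, mul_one, Real.norm_eq_abs, abs_of_pos h]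
    simp only [this, lintegral_const]
    rw [mul_comm, lintegral_lintegral_swap]
    fun_prop
  · apply Measurable.lintegral_prod_right
    fun_prop

/-- The cut-off kernel. -/
def kerE (b ε : ℝ) (p q : R3) : ℝ :=
  if ε ≤ relMom p q then relMom p q ^ (2 - b) / (‖p‖ * ‖q‖) else 0

lemma measurable_relMom : Measurable fun z : R3 × R3 => relMom z.1 z.2 := by
  unfold relMom; fun_prop

lemma measurable_kerE (b ε : ℝ) : Measurable fun z : R3 × R3 => kerE b ε z.1 z.2 := by
  unfold kerE
  have := measurable_relMom
  refine Measurable.ite (measurableSet_le measurable_const this) ?_ measurable_const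
  fun_prop

lemma measurable_pPost : Measurable fun z : R3 × R3 × R3 => pPost z.1 z.2.1 z.2.2 := by
  have : Measurable fun z : R3 × R3 × R3 => relMom z.1 z.2.1 := by
    unfold relMom; fun_prop
  unfold pPost; fun_prop

lemma measurable_qPost : Measurable fun z : R3 × R3 × R3 => qPost z.1 z.2.1 z.2.2 := by
  have : Measurable fun z : R3 × R3 × R3 => relMom z.1 z.2.1 := by
    unfold relMom; fun_prop
  unfold qPost; fun_prop

lemma measurable_Phi (P : R3) : Measurable (Phi P) := by
  unfold Phi uCo enE; fun_prop

lemma relMom_sq_le (p q : R3) : relMom p q ^ 2 ≤ 4 * (‖p‖ * ‖q‖) := by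
  rw [relMom, Real.sq_sqrt]
  · have := (abs_le.1 (abs_real_inner_le_norm p q)).1
    linarith
  · have := real_inner_le_norm p q
    linarith

lemma kerE_nonneg (b ε : ℝ) (p q : R3) : 0 ≤ kerE b ε p q := by
  unfold kerE
  split_ifs
  · have := relMom_nonneg p q
    positivity
  · exact le_rfl

lemma kerE_le {b ε : ℝ} (hb1 : 1 < b) (hε : 0 < ε) (p q : R3) :
    kerE b ε p q ≤ 4 * ε ^ (-b) := by
  unfold kerE
  split_ifs with h
  · have hr : 0 < relMom p q := hε.trans_le h
    have h2 := relMom_sq_le p q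
    have hpq : 0 < ‖p‖ * ‖q‖ := by nlinarith [pow_pos hr 2]
    have h3 : relMom p q ^ (2 - b) = relMom p q ^ 2 * relMom p q ^ (-b) := by
      rw [← Real.rpow_natCast, ← Real.rpow_add hr]; norm_num; rfl
    have h4 : relMom p q ^ (-b) ≤ ε ^ (-b) :=
      Real.rpow_le_rpow_of_nonpos hε h (by linarith)
    have h5 : 0 < relMom p q ^ (-b) := Real.rpow_pos_of_pos hr _
    rw [div_le_iff₀ hpq, h3]
    calc relMom p q ^ 2 * relMom p q ^ (-b) ≤ 4 * (‖p‖ * ‖q‖) * ε ^ (-b) := by gcongr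
      _ = _ := by ring
  · positivity

lemma pPost_Phi (P : R3) {x : R3} (hx : x ≠ 0) (ω : sphere (0 : R3) 1) :
    pPost (Phi P x) (P - Phi P x) ω = Phi P (‖x‖ • (ω : R3)) := by
  have hn : 0 < ‖x‖ := norm_pos_iff.2 hx
  have hE := enE_pos P hx
  have h1 : ‖‖x‖ • (ω : R3)‖ = ‖x‖ := by
    rw [norm_smul, norm_eq_of_mem_sphere, mul_one, norm_norm]
  have h2 : enE P (‖x‖ • (ω : R3)) = enE P x := by simp only [enE, h1]
  rw [pPost, energy_Phi P hx, relMom_Phi P hx, add_sub_cancel, Phi, uCo, h1, h2,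
    inner_smul_right]
  congr 2
  · congr 1; ring
  · field_simp

lemma qPost_eq (p q ω : R3) : qPost p q ω = p + q - pPost p q ω := by
  unfold pPost qPost; module

/-- The kernel in the new variables. -/
def hK (b ε E r : ℝ) : ENNReal :=
  ENNReal.ofReal (if ε ≤ 2 * r then (2 * r) ^ (2 - b) * 4 / (E * (2 * r)) else 0)

lemma jac_mul_ker {b ε : ℝ} (hε : 0 < ε) (P : R3) {x : R3} (hx : x ≠ 0) :
    ENNReal.ofReal (4 * ‖Phi P x‖ * ‖P - Phi P x‖ / (enE P x * (2 * ‖x‖)))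
      * ENNReal.ofReal (kerE b ε (Phi P x) (P - Phi P x)) = hK b ε (enE P x) ‖x‖ := by
  have hn : 0 < ‖x‖ := norm_pos_iff.2 hx
  have hE := enE_pos P hx
  rw [← ENNReal.ofReal_mul (by positivity), hK]
  congr 1
  have h2 := relMom_sq_le (Phi P x) (P - Phi P x)
  rw [kerE]
  rw [relMom_Phi P hx] at *
  have hpq : 0 < ‖Phi P x‖ * ‖P - Phi P x‖ := by nlinarith [pow_pos hn 2]
  split_ifs
  · have ha : ‖Phi P x‖ ≠ 0 := left_ne_zero_of_mul hpq.ne'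
    have hb : ‖P - Phi P x‖ ≠ 0 := right_ne_zero_of_mul hpq.ne'
    generalize (2 * ‖x‖) ^ (2 - b) = c
    field_simp
  · simp

lemma measurable_hK (b ε : ℝ) (P : R3) : Measurable fun x : R3 => hK b ε (enE P x) ‖x‖ := by
  unfold hK enE
  refine Measurable.ennreal_ofReal ?_
  refine Measurable.ite (measurableSet_le measurable_const (by fun_prop)) ?_ measurable_const
  fun_prop

lemma restrict_ker {b ε : ℝ} (hε : 0 < ε) (P : R3) (A : R3 → ENNReal) :
    ∫⁻ p, ENNReal.ofReal (kerE b ε p (P - p)) * A p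
      = ∫⁻ p in {p | 0 < relMom p (P - p)}, ENNReal.ofReal (kerE b ε p (P - p)) * A p := by
  symm
  apply setLIntegral_eq_of_support_subset
  intro p hp
  by_contra h
  apply hp
  have h : ¬ 0 < relMom p (P - p) := h
  have : ¬ ε ≤ relMom p (P - p) := fun h' => h (hε.trans_le h')
  simp [kerE, this]

lemma gain_fixed {b ε : ℝ} (hε : 0 < ε) (P : R3) (F : R3 × R3 → ENNReal) (hF : Measurable F) :
    ∫⁻ p, ENNReal.ofReal (kerE b ε p (P - p)) * ∫⁻ ω : sphere (0 : R3) 1,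
        F (pPost p (P - p) ω, qPost p (P - p) ω) ∂sphMeasure
      = sphMeasure Set.univ *
        ∫⁻ p, ENNReal.ofReal (kerE b ε p (P - p)) * F (p, P - p) := by
  have hm : MeasurableSet ({0}ᶜ : Set R3) := (measurableSet_singleton _).compl
  have hP := measurable_Phi P
  have hh := measurable_hK b ε P
  rw [restrict_ker hε, restrict_ker hε, change_Phi, change_Phi]
  have e1 : ∀ H : R3 → ENNReal, ∫⁻ x in ({0}ᶜ : Set R3), H x = ∫⁻ x, H x := by
    intro H; rw [restrict_compl_singleton]
  have e2 : ∫⁻ x in ({0}ᶜ : Set R3),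
      ENNReal.ofReal (4 * ‖Phi P x‖ * ‖P - Phi P x‖ / (enE P x * (2 * ‖x‖))) *
        (ENNReal.ofReal (kerE b ε (Phi P x) (P - Phi P x)) * F (Phi P x, P - Phi P x))
      = ∫⁻ x in ({0}ᶜ : Set R3), hK b ε (enE P x) ‖x‖ * F (Phi P x, P - Phi P x) := by
    refine setLIntegral_congr_fun hm fun x hx => ?_
    rw [← jac_mul_ker hε P hx, ← mul_assoc]
  have e3 := polar_avg (fun x => hK b ε (enE P x) ‖x‖ * F (Phi P x, P - Phi P x)) (by fun_prop)
  rw [e2, e1 (fun x => hK b ε (enE P x) ‖x‖ * F (Phi P x, P - Phi P x)), ← e3,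
    ← e1 (fun x => ∫⁻ ω : sphere (0 : R3) 1, _ ∂sphMeasure)]
  refine setLIntegral_congr_fun hm fun x hx => ?_
  rw [← mul_assoc (ENNReal.ofReal _) (ENNReal.ofReal _), jac_mul_ker hε P hx, ← lintegral_const_mul']
  · refine lintegral_congr fun ω => ?_
    have h1 : ‖‖x‖ • (ω : R3)‖ = ‖x‖ := by
      rw [norm_smul, norm_eq_of_mem_sphere, mul_one, norm_norm]
    have h2 : enE P (‖x‖ • (ω : R3)) = enE P x := by simp only [enE, h1]
    rw [qPost_eq, pPost_Phi P hx, h1, h2, add_sub_cancel]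
  · exact ENNReal.ofReal_ne_top

lemma shear (A : R3 × R3 → ENNReal) (hA : Measurable A) :
    ∫⁻ p, ∫⁻ q, A (p, q) = ∫⁻ P, ∫⁻ p, A (p, P - p) := by
  rw [lintegral_lintegral_swap (f := fun P p => A (p, P - p)) (by fun_prop)]
  refine lintegral_congr fun p => ?_
  exact (lintegral_sub_right_eq_self (μ := volume) (fun q => A (p, q)) p).symm

lemma gain_eq {b ε : ℝ} (hε : 0 < ε) (F : R3 × R3 → ENNReal) (hF : Measurable F) :
    ∫⁻ p, ∫⁻ q, ∫⁻ ω : sphere (0 : R3) 1, ENNReal.ofReal (kerE b ε p q) *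
        F (pPost p q ω, qPost p q ω) ∂sphMeasure
      = sphMeasure Set.univ * ∫⁻ p, ∫⁻ q, ENNReal.ofReal (kerE b ε p q) * F (p, q) := by
  have : IsFiniteMeasure sphMeasure := by unfold sphMeasure; infer_instance
  have hk := measurable_kerE b ε
  have hpp := measurable_pPost
  have hqq := measurable_qPost
  have hp3 : Measurable fun z : (R3 × R3) × sphere (0 : R3) 1 => pPost z.1.1 z.1.2 z.2 :=
    hpp.comp (g := fun z : R3 × R3 × R3 => pPost z.1 z.2.1 z.2.2)
      (f := fun z : (R3 × R3) × sphere (0 : R3) 1 => (z.1.1, z.1.2, (z.2 : R3))) (by fun_prop)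
  have hq3 : Measurable fun z : (R3 × R3) × sphere (0 : R3) 1 => qPost z.1.1 z.1.2 z.2 :=
    hqq.comp (g := fun z : R3 × R3 × R3 => qPost z.1 z.2.1 z.2.2)
      (f := fun z : (R3 × R3) × sphere (0 : R3) 1 => (z.1.1, z.1.2, (z.2 : R3))) (by fun_prop)
  have hI : Measurable fun z : R3 × R3 => ∫⁻ ω : sphere (0 : R3) 1,
        F (pPost z.1 z.2 ω, qPost z.1 z.2 ω) ∂sphMeasure := by
    apply Measurable.lintegral_prod_right'
      (f := fun z : (R3 × R3) × sphere (0 : R3) 1 => F (pPost z.1.1 z.1.2 z.2,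
        qPost z.1.1 z.1.2 z.2))
    exact hF.comp (hp3.prodMk hq3)
  have hl : ∀ p q : R3, ∫⁻ ω : sphere (0 : R3) 1, ENNReal.ofReal (kerE b ε p q) *
        F (pPost p q ω, qPost p q ω) ∂sphMeasure = ENNReal.ofReal (kerE b ε p q) *
        ∫⁻ ω : sphere (0 : R3) 1, F (pPost p q ω, qPost p q ω) ∂sphMeasure :=
    fun p q => lintegral_const_mul' _ _ ENNReal.ofReal_ne_top
  simp only [hl]
  rw [shear (fun z => ENNReal.ofReal (kerE b ε z.1 z.2) * ∫⁻ ω : sphere (0 : R3) 1,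
        F (pPost z.1 z.2 ω, qPost z.1 z.2 ω) ∂sphMeasure) (hk.ennreal_ofReal.mul hI),
    shear (fun z => ENNReal.ofReal (kerE b ε z.1 z.2) * F z) (hk.ennreal_ofReal.mul hF)]
  simp only [gain_fixed hε _ F hF]
  rw [lintegral_const_mul']
  exact measure_ne_top _ _

lemma ker_bound {b ε : ℝ} (hb1 : 1 < b) (hε : 0 < ε) (a : R3 → ENNReal) (ha : Measurable a) :
    ∫⁻ p, ∫⁻ q, ENNReal.ofReal (kerE b ε p q) * (a p * a q)
      ≤ ENNReal.ofReal (4 * ε ^ (-b)) * (∫⁻ p, a p) ^ 2 := by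
  calc ∫⁻ p, ∫⁻ q, ENNReal.ofReal (kerE b ε p q) * (a p * a q)
      ≤ ∫⁻ p, ∫⁻ q, ENNReal.ofReal (4 * ε ^ (-b)) * (a p * a q) := by
        gcongr with p q
        exact kerE_le hb1 hε p q
    _ = _ := by
        simp only [lintegral_const_mul' _ _ ENNReal.ofReal_ne_top, lintegral_const_mul _ ha]
        rw [lintegral_mul_const _ ha, sq]

/-- The full integrand. -/
def GG (b ε : ℝ) (f : R3 → ℝ) (z : R3 × R3 × sphere (0 : R3) 1) : ℝ :=
  kerE b ε z.1 z.2.1 * (f (pPost z.1 z.2.1 z.2.2) * f (qPost z.1 z.2.1 z.2.2) - f z.1 * f z.2.1)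

instance : IsFiniteMeasure sphMeasure := by unfold sphMeasure; infer_instance

lemma meas_post : Measurable (fun z : R3 × R3 × sphere (0 : R3) 1 =>
    pPost z.1 z.2.1 (z.2.2 : R3)) ∧ Measurable (fun z : R3 × R3 × sphere (0 : R3) 1 =>
    qPost z.1 z.2.1 (z.2.2 : R3)) :=
  ⟨measurable_pPost.comp (g := fun z : R3 × R3 × R3 => pPost z.1 z.2.1 z.2.2)
      (f := fun z : R3 × R3 × sphere (0 : R3) 1 => (z.1, z.2.1, (z.2.2 : R3))) (by fun_prop),
   measurable_qPost.comp (g := fun z : R3 × R3 × R3 => qPost z.1 z.2.1 z.2.2)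
      (f := fun z : R3 × R3 × sphere (0 : R3) 1 => (z.1, z.2.1, (z.2.2 : R3))) (by fun_prop)⟩

lemma meas_ker (b ε : ℝ) : Measurable (fun z : R3 × R3 × sphere (0 : R3) 1 =>
    kerE b ε z.1 z.2.1) :=
  (measurable_kerE b ε).comp (g := fun z : R3 × R3 => kerE b ε z.1 z.2)
    (f := fun z : R3 × R3 × sphere (0 : R3) 1 => (z.1, z.2.1)) (by fun_prop)

/-- The total measure. -/
abbrev muT : Measure (R3 × R3 × sphere (0 : R3) 1) :=
  (volume : Measure R3).prod ((volume : Measure R3).prod sphMeasure)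

lemma lintegral_muT (A : R3 × R3 × sphere (0 : R3) 1 → ENNReal) (hA : Measurable A) :
    ∫⁻ z, A z ∂muT = ∫⁻ p, ∫⁻ q, ∫⁻ ω, A (p, q, ω) ∂sphMeasure := by
  rw [muT, lintegral_prod _ hA.aemeasurable]
  refine lintegral_congr fun p => ?_
  rw [lintegral_prod _ (by fun_prop)]

lemma gain_muT {b ε : ℝ} (hε : 0 < ε) (F : R3 × R3 → ENNReal) (hF : Measurable F) :
    ∫⁻ z : R3 × R3 × sphere (0 : R3) 1, ENNReal.ofReal (kerE b ε z.1 z.2.1) *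
        F (pPost z.1 z.2.1 z.2.2, qPost z.1 z.2.1 z.2.2) ∂muT
      = sphMeasure Set.univ * ∫⁻ p, ∫⁻ q, ENNReal.ofReal (kerE b ε p q) * F (p, q) := by
  rw [lintegral_muT, gain_eq hε F hF]
  exact (meas_ker b ε).ennreal_ofReal.mul (hF.comp (meas_post.1.prodMk meas_post.2))

lemma loss_muT {b ε : ℝ} (F : R3 × R3 → ENNReal) (hF : Measurable F) :
    ∫⁻ z : R3 × R3 × sphere (0 : R3) 1, ENNReal.ofReal (kerE b ε z.1 z.2.1) *
        F (z.1, z.2.1) ∂muT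
      = sphMeasure Set.univ * ∫⁻ p, ∫⁻ q, ENNReal.ofReal (kerE b ε p q) * F (p, q) := by
  rw [lintegral_muT]
  · simp only [lintegral_const]
    simp only [lintegral_mul_const' _ _ (measure_ne_top sphMeasure _)]
    rw [mul_comm]
  · exact (meas_ker b ε).ennreal_ofReal.mul (hF.comp (by fun_prop))

lemma GG_congr {b ε : ℝ} (hε : 0 < ε) (f g : R3 → ℝ) (h : f =ᵐ[volume] g) :
    GG b ε f =ᵐ[muT] GG b ε g := by
  set N := toMeasurable volume {x | f x ≠ g x} with hN
  have hN0 : volume N = 0 := by rw [hN, measure_toMeasurable]; exact h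
  have hNm : MeasurableSet N := measurableSet_toMeasurable _ _
  have hfg : ∀ x, x ∉ N → f x = g x := by
    intro x hx
    by_contra h'
    exact hx (subset_toMeasurable _ _ h')
  set i : R3 → ENNReal := N.indicator 1 with hi
  have him : Measurable i := measurable_one.indicator hNm
  have hi0 : i =ᵐ[volume] 0 := by
    have : ∀ᵐ x, x ∉ N := measure_eq_zero_iff_ae_notMem.1 hN0
    filter_upwards [this] with x hx
    simp [hi, hx]
  let F : R3 × R3 → ENNReal := fun z => i z.1 + i z.2
  have hF : Measurable F := by fun_prop
  have hz : ∫⁻ p, ∫⁻ q, ENNReal.ofReal (kerE b ε p q) * F (p, q) = 0 := by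
    rw [lintegral_eq_zero_of_ae_eq_zero]
    filter_upwards [hi0] with p hp
    apply lintegral_eq_zero_of_ae_eq_zero
    filter_upwards [hi0] with q hq
    simp only [Pi.zero_apply] at hp hq
    simp [F, hp, hq]
  have h1 := gain_muT (b := b) hε F hF
  have h2 := loss_muT (b := b) (ε := ε) F hF
  rw [hz, mul_zero] at h1 h2
  have h1 := (lintegral_eq_zero_iff ((meas_ker b ε).ennreal_ofReal.mul
    (hF.comp (meas_post.1.prodMk meas_post.2)))).1 h1
  have h2 := (lintegral_eq_zero_iff ((meas_ker b ε).ennreal_ofReal.mul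
    (hF.comp (g := F) (f := fun z : R3 × R3 × sphere (0 : R3) 1 => (z.1, z.2.1))
      (by fun_prop)))).1 h2
  filter_upwards [h1, h2] with z hz1 hz2
  unfold GG
  by_cases hk : kerE b ε z.1 z.2.1 = 0
  · simp [hk]
  have hk' : ENNReal.ofReal (kerE b ε z.1 z.2.1) ≠ 0 := by
    have := (kerE_nonneg b ε z.1 z.2.1).lt_of_ne' hk
    simpa using this
  have key : ∀ x, i x = 0 → f x = g x := by
    intro x hx
    apply hfg
    intro hxN
    simp [hi, hxN] at hx
  simp only [Pi.zero_apply, Pi.mul_apply, Function.comp_apply, mul_eq_zero, hk', false_or, F, add_eq_zero] at hz1 hz2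
  rw [key _ hz1.1, key _ hz1.2, key _ hz2.1, key _ hz2.2]

lemma GG_bound {b ε : ℝ} (hb1 : 1 < b) (hε : 0 < ε) (f : R3 → ℝ) (hf : Integrable f) :
    Integrable (GG b ε f) muT ∧ ∫⁻ z, ‖GG b ε f z‖ₑ ∂muT ≤
      2 * (sphMeasure Set.univ * (ENNReal.ofReal (4 * ε ^ (-b)) * (∫⁻ p, ‖f p‖ₑ) ^ 2)) := by
  set g := hf.1.mk f with hg
  have hgm : Measurable g := hf.1.stronglyMeasurable_mk.measurable
  have hfg : f =ᵐ[volume] g := hf.1.ae_eq_mk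
  have hG := GG_congr (b := b) hε f g hfg
  have hGm : Measurable (GG b ε g) := by
    unfold GG
    exact (meas_ker b ε).mul (((hgm.comp meas_post.1).mul (hgm.comp meas_post.2)).sub
      (by fun_prop))
  have hbd : ∫⁻ z, ‖GG b ε f z‖ₑ ∂muT ≤
      2 * (sphMeasure Set.univ * (ENNReal.ofReal (4 * ε ^ (-b)) * (∫⁻ p, ‖f p‖ₑ) ^ 2)) := by
    have e1 : ∫⁻ z, ‖GG b ε f z‖ₑ ∂muT = ∫⁻ z, ‖GG b ε g z‖ₑ ∂muT :=
      lintegral_congr_ae (hG.mono fun z hz => by simp only [hz])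
    have e2 : ∫⁻ p, ‖f p‖ₑ = ∫⁻ p, ‖g p‖ₑ :=
      lintegral_congr_ae (hfg.mono fun z hz => by simp only [hz])
    rw [e1, e2]
    let F : R3 × R3 → ENNReal := fun z => ‖g z.1‖ₑ * ‖g z.2‖ₑ
    have hF : Measurable F := by fun_prop
    calc ∫⁻ z, ‖GG b ε g z‖ₑ ∂muT
        ≤ ∫⁻ z : R3 × R3 × sphere (0 : R3) 1, (ENNReal.ofReal (kerE b ε z.1 z.2.1) *
            F (pPost z.1 z.2.1 z.2.2, qPost z.1 z.2.1 z.2.2)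
            + ENNReal.ofReal (kerE b ε z.1 z.2.1) * F (z.1, z.2.1)) ∂muT := by
          refine lintegral_mono fun z => ?_
          rw [← mul_add, GG, enorm_mul, Real.enorm_of_nonneg (kerE_nonneg b ε _ _)]
          gcongr
          refine (enorm_sub_le).trans ?_
          simp only [enorm_mul, F]
          exact le_rfl
      _ = 2 * (sphMeasure Set.univ *
            ∫⁻ p, ∫⁻ q, ENNReal.ofReal (kerE b ε p q) * F (p, q)) := by
          rw [lintegral_add_left, gain_muT hε F hF, loss_muT F hF, two_mul]
          exact (meas_ker b ε).ennreal_ofReal.mul (hF.comp (meas_post.1.prodMk meas_post.2))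
      _ ≤ _ := by
          gcongr
          exact ker_bound hb1 hε (fun p => ‖g p‖ₑ) (by fun_prop)
  refine ⟨⟨hGm.aestronglyMeasurable.congr hG.symm, ?_⟩, hbd⟩
  refine hbd.trans_lt ?_
  have h1 : ∫⁻ p, ‖f p‖ₑ < ⊤ := hf.2
  have h2 : sphMeasure Set.univ < ⊤ := measure_lt_top _ _
  exact ENNReal.mul_lt_top (by simp) (ENNReal.mul_lt_top h2
    (ENNReal.mul_lt_top ENNReal.ofReal_lt_top (ENNReal.pow_lt_top h1)))

/-- For `ε > 0` the modified collision operator is defined a.e., maps `L¹` to `L¹` and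
satisfies `‖Q_ε(f,f)‖_{L¹} ≤ C_ε ‖f‖_{L¹}²`. -/
theorem Qcoll_L1_bound (C₁ b ε : ℝ) (hC₁ : 0 < C₁) (hb1 : 1 < b) (hb2 : b < 2)
    (hε : 0 < ε) :
    ∃ Cε : ℝ, 0 < Cε ∧ ∀ f : R3 → ℝ, Integrable f →
      (∀ᵐ p : R3, Integrable (fun qω : R3 × sphere (0 : R3) 1 =>
          (if ε ≤ relMom p qω.1 then relMom p qω.1 ^ (2 - b) / (‖p‖ * ‖qω.1‖) else 0)
            * (f (pPost p qω.1 (qω.2 : R3)) * f (qPost p qω.1 (qω.2 : R3)) - f p * f qω.1))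
          ((volume : Measure R3).prod sphMeasure)) ∧
      Integrable (Qcoll C₁ b ε f) ∧
      (∫ p : R3, |Qcoll C₁ b ε f p|) ≤ Cε * (∫ p : R3, |f p|) ^ 2 := by
  
  refine ⟨C₁ * (2 * (sphMeasure.real Set.univ * (4 * ε ^ (-b)))) + 1, by positivity, ?_⟩
  intro f hf
  obtain ⟨hI, hB⟩ := GG_bound hb1 hε f hf
  have hae : ∀ᵐ p : R3, Integrable (fun qω => GG b ε f (p, qω))
      ((volume : Measure R3).prod sphMeasure) := hI.prod_right_ae
  have hQ : Qcoll C₁ b ε f =ᵐ[volume]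
      fun p => C₁ * ∫ qω, GG b ε f (p, qω) ∂((volume : Measure R3).prod sphMeasure) := by
    filter_upwards [hae] with p hp
    rw [integral_prod _ hp]
    rfl
  refine ⟨hae, ?_, ?_⟩
  · exact (hI.integral_prod_left.const_mul C₁).congr hQ.symm
  · have hN : ∫ z, ‖GG b ε f z‖ ∂muT ≤
        2 * (sphMeasure.real Set.univ * (4 * ε ^ (-b))) * (∫ p : R3, |f p|) ^ 2 := by
      have h1 : ∫ p : R3, |f p| = (∫⁻ p, ‖f p‖ₑ).toReal := integral_norm_eq_lintegral_enorm hf.1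
      rw [integral_norm_eq_lintegral_enorm hI.1, h1]
      have hfin : ∫⁻ p, ‖f p‖ₑ < ⊤ := hf.2
      have := ENNReal.toReal_mono ?_ hB
      · refine this.trans_eq ?_
        have h4 : 0 ≤ 4 * ε ^ (-b) := by positivity
        simp only [ENNReal.toReal_mul, ENNReal.toReal_pow, ENNReal.toReal_ofReal h4,
          ENNReal.toReal_ofNat, Measure.real]
        ring
      · exact (ENNReal.mul_lt_top (by simp) (ENNReal.mul_lt_top (measure_lt_top _ _)
          (ENNReal.mul_lt_top ENNReal.ofReal_lt_top (ENNReal.pow_lt_top hfin)))).ne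
    calc ∫ p : R3, |Qcoll C₁ b ε f p|
        = ∫ p : R3, C₁ * ‖∫ qω, GG b ε f (p, qω) ∂((volume : Measure R3).prod sphMeasure)‖ := by
          refine integral_congr_ae (hQ.mono fun p hp => ?_)
          simp only [hp, abs_mul, abs_of_pos hC₁, Real.norm_eq_abs]
      _ = C₁ * ∫ p : R3, ‖∫ qω, GG b ε f (p, qω) ∂((volume : Measure R3).prod sphMeasure)‖ :=
          integral_const_mul _ _
      _ ≤ C₁ * ∫ p : R3, ∫ qω, ‖GG b ε f (p, qω)‖ ∂((volume : Measure R3).prod sphMeasure) := by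
          refine mul_le_mul_of_nonneg_left ?_ hC₁.le
          exact integral_mono hI.integral_prod_left.norm hI.norm.integral_prod_left
            fun p => norm_integral_le_integral_norm _
      _ = C₁ * ∫ z, ‖GG b ε f z‖ ∂muT := by
          rw [integral_prod _ hI.norm]
      _ ≤ C₁ * (2 * (sphMeasure.real Set.univ * (4 * ε ^ (-b))) * (∫ p : R3, |f p|) ^ 2) := by
          gcongr
      _ ≤ _ := by
          nlinarith [sq_nonneg (∫ p : R3, |f p|)]
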